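/- Let m, n ∈ ℕ, T > 0, Q an n×n real matrix, E an n×m real matrix, c ∈ ℝⁿ, β₀ ∈ ℝⁿ, and let F : ℝᵐ × ℝⁿ → ℝᵐ satisfy ‖F(a,b) − F(a′,b′)‖ ≤ c_α‖a − a′‖ + c_β‖b − b′‖ for all a, a′ ∈ ℝᵐ and b, b′ ∈ ℝⁿ, where c_α ∈ [0,1) and c_β ≥ 0. Then there exists exactly one pair of functions α : [0,T] → ℝᵐ continuous and β : [0,T] → ℝⁿ continuously differentiable such that for all t ∈ [0,T]: α(t) = F(α(t), β(t)), β′(t) = −Q β(t) + c + E α(t), and β(0) = β₀. -/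

import Mathlib

/-- Matrix–vector multiplication viewed as a map on Euclidean spaces. -/
noncomputable def matVecMul {n m : ℕ} (A : Matrix (Fin n) (Fin m) ℝ)
    (v : EuclideanSpace ℝ (Fin m)) : EuclideanSpace ℝ (Fin n) :=
  Matrix.toEuclideanLin A v

open Set in
/-- Local existence with explicit step size for a Lipschitz vector field. -/
lemma lipODE_local {X : Type*} [NormedAddCommGroup X] [NormedSpace ℝ X] [CompleteSpace X]
    {v : X → X} {K : NNReal} (hv : LipschitzWith K v) {h : ℝ} (hh : 0 ≤ h)
    (hK : (K : ℝ) * h ≤ 1 / 2) (x₀ : X) :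
    ∃ f : ℝ → X, f 0 = x₀ ∧ ∀ t ∈ Icc 0 h, HasDerivWithinAt f (v (f t)) (Icc 0 h) t := by
  let a : NNReal := 2 * ⟨h, hh⟩ * ‖v x₀‖₊
  let L : NNReal := ‖v x₀‖₊ + K * a
  have ha : (a : ℝ) = 2 * h * ‖v x₀‖ := rfl
  have hL : (L : ℝ) = ‖v x₀‖ + K * a := by simp [L]
  have hp : IsPicardLindelof (fun _ : ℝ => v) (tmin := 0) (tmax := h) ⟨0, le_rfl, hh⟩ x₀ a 0 L K := by
    apply IsPicardLindelof.of_time_independent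
    · intro x hx
      have h1 := hv.dist_le_mul x x₀
      rw [Metric.mem_closedBall] at hx
      rw [dist_eq_norm] at h1
      have h2 : ‖v x‖ ≤ ‖v x₀‖ + ‖v x - v x₀‖ := by
        have := norm_add_le (v x₀) (v x - v x₀)
        simpa using this
      have h3 : (K : ℝ) * dist x x₀ ≤ K * a := mul_le_mul_of_nonneg_left hx K.2
      rw [hL]; linarith
    · exact hv.lipschitzOnWith
    · have : max (h - 0) ((0 : ℝ) - 0) = h := by simp [hh]
      simp only [this, NNReal.coe_zero]
      rw [hL]
      have h4 : (K : ℝ) * h * a ≤ 1 / 2 * a := mul_le_mul_of_nonneg_right hK a.2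
      nlinarith
  obtain ⟨f, hf, hf'⟩ := hp.exists_eq_forall_mem_Icc_hasDerivWithinAt₀
  exact ⟨f, hf, hf'⟩

open Set in
/-- Global existence for a Lipschitz vector field on `[0, N h]`. -/
lemma lipODE_steps {X : Type*} [NormedAddCommGroup X] [NormedSpace ℝ X] [CompleteSpace X]
    {v : X → X} {K : NNReal} (hv : LipschitzWith K v) {h : ℝ} (hh : 0 ≤ h)
    (hK : (K : ℝ) * h ≤ 1 / 2) (x₀ : X) (N : ℕ) :
    ∃ f : ℝ → X, f 0 = x₀ ∧
      ∀ t ∈ Icc 0 (N * h), HasDerivWithinAt f (v (f t)) (Icc 0 (N * h)) t := by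
  induction N with
  | zero =>
    refine ⟨fun _ => x₀, rfl, fun t _ => ?_⟩
    simp only [Nat.cast_zero, zero_mul, Icc_self]
    exact HasFDerivWithinAt.of_subsingleton subsingleton_singleton
  | succ N ih =>
    obtain ⟨f, hf0, hf⟩ := ih
    set A : ℝ := N * h with hA
    have hA0 : 0 ≤ A := by positivity
    obtain ⟨g, hg0, hg⟩ := lipODE_local hv hh hK (f A)
    have hB : ((N + 1 : ℕ) : ℝ) * h = A + h := by push_cast; rw [hA]; ring
    rw [hB]
    let k : ℝ → X := fun t => if t ≤ A then f t else g (t - A)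
    have hk1 : ∀ t ∈ Icc 0 A, k t = f t := fun t ht => if_pos ht.2
    have hk2 : ∀ t ∈ Icc A (A + h), k t = g (t - A) := by
      intro t ht
      rcases ht.1.eq_or_lt with rfl | hlt
      · simp [k, hg0]
      · exact if_neg (not_le.2 hlt)
    refine ⟨k, by rw [hk1 0 ⟨le_rfl, hA0⟩, hf0], fun t ht => ?_⟩
    rw [← Icc_union_Icc_eq_Icc hA0 (by linarith : A ≤ A + h)]
    apply HasDerivWithinAt.union
    · by_cases htA : t ∈ Icc 0 A
      · rw [hk1 t htA]
        exact (hf t htA).congr hk1 (hk1 t htA)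
      · exact HasFDerivWithinAt.of_notMem_closure (by rwa [isClosed_Icc.closure_eq])
    · by_cases htA : t ∈ Icc A (A + h)
      · rw [hk2 t htA]
        have h1 := hg (t - A) (Set.mem_Icc.2 ⟨by linarith [htA.1], by linarith [htA.2]⟩)
        have h2 : HasDerivWithinAt (fun s : ℝ => s - A) 1 (Icc A (A + h)) t :=
          ((hasDerivAt_id t).sub_const A).hasDerivWithinAt
        have h3 := HasDerivWithinAt.scomp t h1 h2
          (fun s hs => Set.mem_Icc.2 ⟨by linarith [hs.1], by linarith [hs.2]⟩)
        rw [one_smul] at h3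
        exact h3.congr hk2 (hk2 t htA)
      · exact HasFDerivWithinAt.of_notMem_closure (by rwa [isClosed_Icc.closure_eq])

open Set in
/-- Global existence for a Lipschitz vector field. -/
lemma lipODE_global {X : Type*} [NormedAddCommGroup X] [NormedSpace ℝ X] [CompleteSpace X]
    {v : X → X} {K : NNReal} (hv : LipschitzWith K v) {T : ℝ} (hT : 0 < T) (x₀ : X) :
    ∃ f : ℝ → X, f 0 = x₀ ∧ ∀ t ∈ Icc 0 T, HasDerivWithinAt f (v (f t)) (Icc 0 T) t := by
  obtain ⟨N, hN⟩ := exists_nat_gt (2 * K * T)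
  have hN0 : (0 : ℝ) < N := lt_of_le_of_lt (by positivity) hN
  have := lipODE_steps hv (h := T / N) (by positivity)
    (by rw [← mul_div_assoc, div_le_iff₀ hN0]; linarith) x₀ N
  rwa [mul_div_cancel₀ _ hN0.ne'] at this

/-- Existence and uniqueness for the coupled algebraic/ODE Galerkin coefficient system:
`α(t) = F(α(t), β(t))`, `β'(t) = -Qβ(t) + c + Eα(t)`, `β(0) = β₀` on `[0,T]`,
with `α` continuous and `β` continuously differentiable. -/
theorem galerkin_coefficient_system_wellposed
    (m n : ℕ) (T : ℝ) (hT : 0 < T)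
    (Q : Matrix (Fin n) (Fin n) ℝ) (E : Matrix (Fin n) (Fin m) ℝ)
    (c β₀ : EuclideanSpace ℝ (Fin n))
    (F : EuclideanSpace ℝ (Fin m) × EuclideanSpace ℝ (Fin n) → EuclideanSpace ℝ (Fin m))
    (c_α c_β : ℝ) (hcα0 : 0 ≤ c_α) (hcα1 : c_α < 1) (hcβ0 : 0 ≤ c_β)
    (hF : ∀ (a a' : EuclideanSpace ℝ (Fin m)) (b b' : EuclideanSpace ℝ (Fin n)),
      ‖F (a, b) - F (a', b')‖ ≤ c_α * ‖a - a'‖ + c_β * ‖b - b'‖) :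
    ∃ (α : ℝ → EuclideanSpace ℝ (Fin m)) (β : ℝ → EuclideanSpace ℝ (Fin n)),
      (ContinuousOn α (Set.Icc 0 T) ∧
        (∀ t ∈ Set.Icc (0:ℝ) T, α t = F (α t, β t)) ∧
        (∀ t ∈ Set.Icc (0:ℝ) T,
          HasDerivWithinAt β (-(matVecMul Q (β t)) + c + matVecMul E (α t)) (Set.Icc 0 T) t) ∧
        ContinuousOn (fun t => -(matVecMul Q (β t)) + c + matVecMul E (α t)) (Set.Icc 0 T) ∧
        β 0 = β₀) ∧
      (∀ (α' : ℝ → EuclideanSpace ℝ (Fin m)) (β' : ℝ → EuclideanSpace ℝ (Fin n)),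
        (ContinuousOn α' (Set.Icc 0 T) ∧
          (∀ t ∈ Set.Icc (0:ℝ) T, α' t = F (α' t, β' t)) ∧
          (∀ t ∈ Set.Icc (0:ℝ) T,
            HasDerivWithinAt β' (-(matVecMul Q (β' t)) + c + matVecMul E (α' t)) (Set.Icc 0 T) t) ∧
          ContinuousOn (fun t => -(matVecMul Q (β' t)) + c + matVecMul E (α' t)) (Set.Icc 0 T) ∧
          β' 0 = β₀) →
        ∀ t ∈ Set.Icc (0:ℝ) T, α' t = α t ∧ β' t = β t) := by
  classical
  have hcontr : ∀ b, ContractingWith ⟨c_α, hcα0⟩ (fun a => F (a, b)) := by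
    intro b
    refine ⟨by exact_mod_cast hcα1, LipschitzWith.of_dist_le_mul fun a a' => ?_⟩
    have := hF a a' b b
    rw [sub_self, norm_zero, mul_zero, add_zero] at this
    rw [dist_eq_norm, dist_eq_norm]
    exact this
  choose S hS using fun b => (show ∃ a, F (a, b) = a from ⟨_, (hcontr b).fixedPoint_isFixedPt⟩)
  have hd : 0 < 1 - c_α := by linarith
  have key : ∀ a a' b b', a = F (a, b) → a' = F (a', b') →
      ‖a - a'‖ ≤ c_β / (1 - c_α) * ‖b - b'‖ := by
    intro a a' b b' h h'
    have h1 := hF a a' b b'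
    rw [← h, ← h'] at h1
    rw [div_mul_eq_mul_div, le_div_iff₀ hd]
    linarith
  have huniq : ∀ a b, a = F (a, b) → a = S b := by
    intro a b h
    have := key a (S b) b b h (hS b).symm
    rw [sub_self, norm_zero, mul_zero] at this
    exact sub_eq_zero.1 (norm_le_zero_iff.1 this)
  have hSL : LipschitzWith (⟨c_β / (1 - c_α), by positivity⟩ : NNReal) S :=
    LipschitzWith.of_dist_le_mul fun b b' => by
      rw [dist_eq_norm, dist_eq_norm]
      exact key _ _ b b' (hS b).symm (hS b').symm
  have hQL := (Matrix.toEuclideanLin Q).toContinuousLinearMap.lipschitz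
  have hEL := (Matrix.toEuclideanLin E).toContinuousLinearMap.lipschitz
  obtain ⟨K, hv⟩ : ∃ K, LipschitzWith K
      (fun b => -(matVecMul Q b) + c + matVecMul E (S b)) :=
    ⟨_, (hQL.neg.add (LipschitzWith.const c)).add (hEL.comp hSL)⟩
  obtain ⟨β, hβ0, hβ⟩ := lipODE_global hv hT β₀
  have hβc : ContinuousOn β (Set.Icc 0 T) := fun t ht => (hβ t ht).continuousWithinAt
  refine ⟨fun t => S (β t), β, ⟨hSL.continuous.comp_continuousOn hβc,
    fun t _ => (hS (β t)).symm, hβ, hv.continuous.comp_continuousOn hβc, hβ0⟩, ?_⟩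
  rintro α' β' ⟨-, hα', hβ', -, hβ'0⟩
  have hright : ∀ (f f' : ℝ → EuclideanSpace ℝ (Fin n)),
      (∀ t ∈ Set.Icc 0 T, HasDerivWithinAt f (f' t) (Set.Icc 0 T) t) →
      ∀ t ∈ Set.Ico 0 T, HasDerivWithinAt f (f' t) (Set.Ici t) t := by
    intro f f' hf t ht
    exact (hf t ⟨ht.1, ht.2.le⟩).mono_of_mem_nhdsWithin
      (Filter.mem_of_superset (Icc_mem_nhdsGE ht.2) (Set.Icc_subset_Icc_left ht.1))
  have hβ'2 : ∀ t ∈ Set.Icc 0 T, HasDerivWithinAt β'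
      ((fun b => -(matVecMul Q b) + c + matVecMul E (S b)) (β' t)) (Set.Icc 0 T) t := by
    intro t ht
    have := hβ' t ht
    rwa [huniq _ _ (hα' t ht)] at this
  have heq : Set.EqOn β' β (Set.Icc 0 T) :=
    ODE_solution_unique (v := fun _ b => -(matVecMul Q b) + c + matVecMul E (S b))
      (fun _ => hv) (fun t ht => (hβ' t ht).continuousWithinAt) (hright _ _ hβ'2)
      hβc (hright _ _ hβ) (hβ'0.trans hβ0.symm)
  intro t ht
  refine ⟨?_, heq ht⟩
  rw [huniq _ _ (hα' t ht), heq ht]
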